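/- Let n, m be positive integers with m < n. Let E ⊆ ℝⁿ be an m-rectifiable set (ℋᵐ-measurable, ℋᵐ(E) > 0, covered up to an ℋᵐ-null set by countably many C¹ embeddings of ℝᵐ into ℝⁿ) which is not m-flat, i.e., E is not contained in any affine m-plane. Then there exists a point x ∈ E such that the radial projection π_x(E \ {x}) has positive ℋᵐ measure. -/

import Mathlib

open MeasureTheory Metric Set
open scoped ENNReal

/-- The radial projection from `x`, mapping `y ≠ x` to `(y - x)/‖y - x‖ ∈ S^{n-1}`. -/
noncomputable def radialProj {n : ℕ} (x y : EuclideanSpace ℝ (Fin n)) : EuclideanSpace ℝ (Fin n) :=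
  ‖y - x‖⁻¹ • (y - x)

/-- A `C¹` embedding: continuously differentiable and a homeomorphism onto its image. -/
def IsC1Embedding {m n : ℕ} (f : EuclideanSpace ℝ (Fin m) → EuclideanSpace ℝ (Fin n)) : Prop :=
  ContDiff ℝ 1 f ∧ Topology.IsEmbedding f

/-- `T` is an affine `k`-plane: a translate of a `k`-dimensional linear subspace. -/
def IsAffinePlane {n : ℕ} (k : ℕ) (T : Set (EuclideanSpace ℝ (Fin n))) : Prop :=
  ∃ (W : Submodule ℝ (EuclideanSpace ℝ (Fin n))) (v : EuclideanSpace ℝ (Fin n)),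
    Module.finrank ℝ W = k ∧ T = (fun w => v + w) '' (W : Set (EuclideanSpace ℝ (Fin n)))

/-- `E` is `m`-rectifiable: `ℋᵐ`-measurable, of positive `ℋᵐ` measure, and covered up to an
`ℋᵐ`-null set by countably many `C¹` embeddings of `ℝᵐ` into `ℝⁿ`. -/
def IsRectifiableSet (m n : ℕ) (E : Set (EuclideanSpace ℝ (Fin n))) : Prop :=
  NullMeasurableSet E (μH[(m : ℝ)]) ∧ 0 < μH[(m : ℝ)] E ∧
  ∃ f : ℕ → (EuclideanSpace ℝ (Fin m) → EuclideanSpace ℝ (Fin n)),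
    (∀ i, IsC1Embedding (f i)) ∧ μH[(m : ℝ)] (E \ ⋃ i, Set.range (f i)) = 0

open Topology NNReal in
theorem hausdorffMeasure_image_le_of_dist_le {α X Y : Type*}
    [MetricSpace X] [MeasurableSpace X] [BorelSpace X]
    [MetricSpace Y] [MeasurableSpace Y] [BorelSpace Y]
    {f : α → X} {g : α → Y} {s : Set α} {K : ℝ≥0} {d : ℝ} (hd : 0 ≤ d)
    (h : ∀ x ∈ s, ∀ y ∈ s, dist (f x) (f y) ≤ K * dist (g x) (g y)) :
    μH[d] (f '' s) ≤ (K : ℝ≥0∞) ^ d * μH[d] (g '' s) := by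
  rcases s.eq_empty_or_nonempty with rfl | ⟨a, -⟩
  · simp
  have : Nonempty α := ⟨a⟩
  have hinv : ∀ y ∈ g '' s, Function.invFunOn g s y ∈ s ∧ g (Function.invFunOn g s y) = y :=
    fun y hy => ⟨Function.invFunOn_mem hy, Function.invFunOn_eq hy⟩
  have hlip : LipschitzOnWith K (f ∘ Function.invFunOn g s) (g '' s) := by
    refine LipschitzOnWith.of_dist_le_mul fun y hy z hz => ?_
    simpa [(hinv y hy).2, (hinv z hz).2] using h _ (hinv y hy).1 _ (hinv z hz).1
  refine le_trans (measure_mono ?_) (hlip.hausdorffMeasure_image_le hd)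
  rintro _ ⟨x, hx, rfl⟩
  have hgx := mem_image_of_mem g hx
  refine ⟨g x, hgx, ?_⟩
  have := h _ (hinv _ hgx).1 _ hx
  rw [(hinv _ hgx).2, dist_self, mul_zero] at this
  exact dist_le_zero.1 this

section SingularDerivative

variable {V F : Type*} [NormedAddCommGroup V] [InnerProductSpace ℝ V] [FiniteDimensional ℝ V]
  [NormedAddCommGroup F] [NormedSpace ℝ F]

open Topology NNReal in
/-- A linear map with nontrivial kernel is dominated in norm, with room to spare, by an
endomorphism of arbitrarily small determinant. -/
theorem exists_abs_det_le_and_norm_add_le {A : V →L[ℝ] F} (hA : ¬ Function.Injective A)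
    {δ : ℝ} (hδ : 0 < δ) :
    ∃ r : ℝ≥0, 0 < r ∧ ∃ S : V →L[ℝ] V, |S.det| ≤ δ ∧ ∀ x, ‖A x‖ + r * ‖x‖ ≤ ‖S x‖ := by
  obtain ⟨v, hv, hAv⟩ : ∃ v, ‖v‖ = 1 ∧ A v = 0 := by
    rw [injective_iff_map_eq_zero] at hA
    push Not at hA
    obtain ⟨w, hw, hw0⟩ := hA
    refine ⟨‖w‖⁻¹ • w, ?_, by simp [hw]⟩
    rw [norm_smul, norm_inv, norm_norm, inv_mul_cancel₀ (norm_ne_zero_iff.2 hw0)]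
  have hvv : inner ℝ v v = 1 := by rw [real_inner_self_eq_norm_sq, hv]; norm_num
  let P : V →L[ℝ] V := (innerSL ℝ v).smulRight v
  let S : ℝ → V →L[ℝ] V := fun t => (‖A‖ + 2) • (ContinuousLinearMap.id ℝ V - (1 - t) • P)
  have hS : Continuous fun t => |(S t).det| := by
    refine (ContinuousLinearMap.continuous_det.comp ?_).abs
    fun_prop
  have hS0 : |(S 0).det| = 0 := by
    rw [abs_eq_zero]
    by_contra h
    have hinj : LinearMap.ker (S 0 : V →ₗ[ℝ] V) = ⊥ := by
      by_contra hk
      exact h (LinearMap.det_eq_zero_iff_ker_ne_bot.2 hk)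
    have : v = 0 := by
      have := LinearMap.ker_eq_bot'.1 hinj v
      apply this
      simp [S, P, hv]
    simp [this] at hv
  have hev : ∀ᶠ t in 𝓝[>] (0 : ℝ), |(S t).det| ≤ δ := by
    have := hS.tendsto 0
    rw [hS0] at this
    exact ((this.eventually (ge_mem_nhds hδ))).filter_mono nhdsWithin_le_nhds
  obtain ⟨t, ⟨htδ, ht0⟩, ht1⟩ := ((hev.and self_mem_nhdsWithin).and
    (nhdsWithin_le_nhds (ge_mem_nhds (zero_lt_one' ℝ)))).exists
  have ht0 : 0 < t := ht0
  refine ⟨⟨t, ht0.le⟩, ht0, S t, htδ, fun x => ?_⟩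
  set c : ℝ := inner ℝ v x
  set p : V := x - c • v
  have hpv : inner ℝ p v = 0 := by
    simp only [p, inner_sub_left, inner_smul_left, hvv]
    simp [c, real_inner_comm]
  have hAx : A x = A p := by simp [p, hAv]
  have hSx : S t x = (‖A‖ + 2) • (p + (t * c) • v) := by
    simp only [S, P, p, c, FunLike.coe_smul, Pi.smul_apply, FunLike.coe_sub, Pi.sub_apply,
      ContinuousLinearMap.smulRight_apply, innerSL_apply_apply, ContinuousLinearMap.id_apply]
    module
  have hsq : ‖p + (t * c) • v‖ ^ 2 = ‖p‖ ^ 2 + (t * c) ^ 2 := by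
    rw [norm_add_sq_real, inner_smul_right, hpv, norm_smul, hv, mul_one, Real.norm_eq_abs, sq_abs]
    ring
  set N := ‖p + (t * c) • v‖
  have hN : 0 ≤ N := norm_nonneg _
  have hpN : ‖p‖ ≤ N := by
    refine abs_le_of_sq_le_sq' ?_ hN |>.2
    nlinarith [sq_nonneg (t * c)]
  have hcN : t * |c| ≤ N := by
    refine abs_le_of_sq_le_sq' ?_ hN |>.2
    rw [mul_pow, sq_abs]
    nlinarith [sq_nonneg ‖p‖]
  have hx : ‖x‖ ≤ ‖p‖ + |c| := by
    calc ‖x‖ = ‖p + c • v‖ := by simp [p]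
      _ ≤ ‖p‖ + ‖c • v‖ := norm_add_le _ _
      _ = ‖p‖ + |c| := by rw [norm_smul, hv, mul_one, Real.norm_eq_abs]
  have hAp : ‖A p‖ ≤ ‖A‖ * N := (A.le_opNorm p).trans (by gcongr)
  have htp : t * ‖p‖ ≤ N := (mul_le_of_le_one_left (norm_nonneg p) ht1).trans hpN
  have htx : t * ‖x‖ ≤ t * (‖p‖ + |c|) := by gcongr
  rw [hAx, hSx, norm_smul, Real.norm_of_nonneg (by positivity)]
  change ‖A p‖ + t * ‖x‖ ≤ (‖A‖ + 2) * N
  linarith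

variable [MeasurableSpace V] [BorelSpace V] [MeasurableSpace F] [BorelSpace F]

open Module Topology NNReal in
theorem hausdorffMeasure_image_eq_zero_of_hasFDerivAt [SecondCountableTopology F]
    {f : V → F} {f' : V → V →L[ℝ] F} {s : Set V} (hf : ∀ x ∈ s, HasFDerivAt f (f' x) x)
    (hs : μH[finrank ℝ V] s = 0) : μH[finrank ℝ V] (f '' s) = 0 := by
  obtain ⟨t, A, -, -, hst, happ, -⟩ := exists_partition_approximatesLinearOn_of_hasFDerivWithinAt
    f s f' (fun x hx => (hf x hx).hasFDerivWithinAt) (fun _ => 1) (fun _ => one_ne_zero)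
  have hcov : f '' s ⊆ ⋃ n, f '' (s ∩ t n) := by
    rw [← image_iUnion, ← inter_iUnion]
    exact image_mono fun x hx => ⟨hx, hst hx⟩
  refine measure_mono_null hcov (measure_iUnion_null fun n => ?_)
  have hlip : LipschitzOnWith (‖A n‖₊ + 1) f (s ∩ t n) := by
    rw [lipschitzOnWith_iff_restrict]
    exact (happ n).lipschitz
  refine le_antisymm ((hlip.hausdorffMeasure_image_le (Nat.cast_nonneg _)).trans ?_) zero_le
  rw [measure_mono_null inter_subset_left hs, mul_zero]

open Module Topology NNReal in
/-- A Sard-type statement: the set of critical values of a map out of an `m`-dimensional space,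
that is the image of the points where the derivative is not injective, is `ℋᵐ`-null. -/
theorem hausdorffMeasure_image_eq_zero_of_not_injective [SecondCountableTopology F]
    {f : V → F} {f' : V → V →L[ℝ] F} {s : Set V} (hf : ∀ x ∈ s, HasFDerivAt f (f' x) x)
    (hinj : ∀ x ∈ s, ¬ Function.Injective (f' x)) : μH[finrank ℝ V] (f '' s) = 0 := by
  wlog hb : ∃ R, s ⊆ closedBall (0 : V) R generalizing s
  · have hcov : f '' s ⊆ ⋃ n : ℕ, f '' (s ∩ closedBall 0 n) := by
      rw [← image_iUnion, ← inter_iUnion, iUnion_closedBall_nat, inter_univ]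
    exact measure_mono_null hcov <| measure_iUnion_null fun n =>
      this (fun x hx => hf x hx.1) (fun x hx => hinj x hx.1) ⟨n, inter_subset_right⟩
  obtain ⟨R, hR⟩ := hb
  rcases s.eq_empty_or_nonempty with rfl | hne
  · simp
  set μ : Measure V := μH[finrank ℝ V]
  have hfin : μ (closedBall 0 R) ≠ ∞ := (isCompact_closedBall (0 : V) R).measure_lt_top.ne
  have key : ∀ δ : ℝ≥0, 0 < δ → μH[finrank ℝ V] (f '' s) ≤ δ * μ (closedBall 0 R) := by
    intro δ hδ
    have hex : ∀ A : V →L[ℝ] F, ∃ r : ℝ≥0, r ≠ 0 ∧ (¬ Function.Injective A →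
        ∃ S : V →L[ℝ] V, |S.det| ≤ δ ∧ ∀ x, ‖A x‖ + r * ‖x‖ ≤ ‖S x‖) := by
      intro A
      by_cases hA : Function.Injective A
      · exact ⟨1, one_ne_zero, fun h => absurd hA h⟩
      · obtain ⟨r, hr, hS⟩ := exists_abs_det_le_and_norm_add_le hA (δ := δ) hδ
        exact ⟨r, hr.ne', fun _ => hS⟩
    choose r hr0 hrS using hex
    obtain ⟨t, A, hdisj, hmeas, hst, happ, hA⟩ :=
      exists_partition_approximatesLinearOn_of_hasFDerivWithinAt
        f s f' (fun x hx => (hf x hx).hasFDerivWithinAt) r hr0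
    have hcov : f '' s ⊆ ⋃ n, f '' (s ∩ t n) := by
      rw [← image_iUnion, ← inter_iUnion]
      exact image_mono fun x hx => ⟨hx, hst hx⟩
    have hpiece : ∀ n, μH[finrank ℝ V] (f '' (s ∩ t n)) ≤ δ * μ (closedBall 0 R ∩ t n) := by
      intro n
      obtain ⟨y, hy, hAy⟩ := hA hne n
      obtain ⟨S, hdet, hS⟩ := hrS (A n) (hAy ▸ hinj y hy)
      have hdist : ∀ x ∈ s ∩ t n, ∀ z ∈ s ∩ t n,
          dist (f x) (f z) ≤ (1 : ℝ≥0) * dist (S x) (S z) := by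
        intro x hx z hz
        rw [dist_eq_norm, dist_eq_norm, ← map_sub, NNReal.coe_one, one_mul]
        calc ‖f x - f z‖ = ‖A n (x - z) + (f x - f z - A n (x - z))‖ := by congr 1; abel
          _ ≤ ‖A n (x - z)‖ + ‖f x - f z - A n (x - z)‖ := norm_add_le _ _
          _ ≤ ‖A n (x - z)‖ + r (A n) * ‖x - z‖ := by gcongr; exact happ n x hx z hz
          _ ≤ ‖S (x - z)‖ := hS _
      calc μH[finrank ℝ V] (f '' (s ∩ t n)) ≤ μ (S '' (s ∩ t n)) := by
            refine (hausdorffMeasure_image_le_of_dist_le (Nat.cast_nonneg _) hdist).trans_eq ?_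
            rw [ENNReal.coe_one, ENNReal.one_rpow, one_mul]
        _ = ENNReal.ofReal |S.det| * μ (s ∩ t n) := Measure.addHaar_image_continuousLinearMap μ S _
        _ ≤ δ * μ (closedBall 0 R ∩ t n) := by
            gcongr
            exact ENNReal.ofReal_le_of_le_toReal hdet
    calc μH[finrank ℝ V] (f '' s) ≤ ∑' n, μH[finrank ℝ V] (f '' (s ∩ t n)) :=
          (measure_mono hcov).trans (measure_iUnion_le _)
      _ ≤ ∑' n, δ * μ (closedBall 0 R ∩ t n) := ENNReal.tsum_le_tsum hpiece
      _ = δ * μ (⋃ n, closedBall 0 R ∩ t n) := by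
          rw [ENNReal.tsum_mul_left, measure_iUnion
            (fun i j hij => (hdisj hij).mono inter_subset_right inter_subset_right)
            fun n => measurableSet_closedBall.inter (hmeas n)]
      _ ≤ δ * μ (closedBall 0 R) := by
          gcongr
          exact iUnion_subset fun n => inter_subset_left
  have hlim : Filter.Tendsto (fun δ : ℝ≥0 => (δ : ℝ≥0∞) * μ (closedBall 0 R)) (𝓝[>] 0) (𝓝 0) := by
    have : Filter.Tendsto (fun δ : ℝ≥0 => (δ : ℝ≥0∞) * μ (closedBall 0 R)) (𝓝 0) (𝓝 (0 * _)) :=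
      ENNReal.Tendsto.mul_const (ENNReal.tendsto_coe.2 Filter.tendsto_id) (Or.inr hfin)
    rw [zero_mul] at this
    exact this.mono_left nhdsWithin_le_nhds
  refine le_antisymm (ge_of_tendsto hlim ?_) zero_le
  filter_upwards [self_mem_nhdsWithin] with δ hδ using key δ hδ

end SingularDerivative

section InjectiveDerivative

variable {V F : Type*} [NormedAddCommGroup V] [NormedSpace ℝ V] [FiniteDimensional ℝ V]
  [NormedAddCommGroup F] [NormedSpace ℝ F]
  [MeasurableSpace V] [BorelSpace V] [MeasurableSpace F] [BorelSpace F]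

open Topology NNReal in
/-- A map with injective strict derivatives reflects Hausdorff null sets. -/
theorem hausdorffMeasure_eq_zero_of_image_of_hasStrictFDerivAt
    {g : V → F} {g' : V → V →L[ℝ] F} {s : Set V} {d : ℝ} (hd : 0 ≤ d)
    (hg : ∀ x ∈ s, HasStrictFDerivAt g (g' x) x) (hinj : ∀ x ∈ s, Function.Injective (g' x))
    (h0 : μH[d] (g '' s) = 0) : μH[d] s = 0 := by
  refine measure_null_of_locally_null s fun a ha => ?_
  obtain ⟨K, hK, hanti⟩ := (g' a : V →ₗ[ℝ] F).exists_antilipschitzWith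
    (LinearMap.ker_eq_bot.2 (hinj a ha))
  obtain ⟨u, hu, happ⟩ := (hg a ha).approximates_deriv_on_nhds (c := (2 * K)⁻¹)
    (Or.inr (by positivity))
  refine ⟨s ∩ u, inter_mem_nhdsWithin s hu, ?_⟩
  have hdist : ∀ x ∈ s ∩ u, ∀ y ∈ s ∩ u, dist x y ≤ ((2 * K : ℝ≥0) : ℝ) * dist (g x) (g y) := by
    intro x hx y hy
    have h1 : dist x y ≤ K * dist (g' a x) (g' a y) := hanti.le_mul_dist x y
    have h2 := happ x hx.2 y hy.2
    rw [dist_eq_norm, dist_eq_norm, ← map_sub] at h1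
    rw [dist_eq_norm, dist_eq_norm]
    have h3 : ‖g' a (x - y)‖ ≤ ‖g x - g y‖ + ‖g x - g y - g' a (x - y)‖ := by
      rw [norm_sub_rev (g x - g y) (g' a (x - y))]
      exact norm_le_norm_add_norm_sub' _ _
    have hK' : (0 : ℝ) < K := hK
    have h4 : (K : ℝ) * ‖g' a (x - y)‖ ≤ K * (‖g x - g y‖ + (2 * K : ℝ)⁻¹ * ‖x - y‖) := by
      gcongr
      refine h3.trans ?_
      gcongr
      simpa using h2
    have h5 : (K : ℝ) * (‖g x - g y‖ + (2 * K : ℝ)⁻¹ * ‖x - y‖)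
        = K * ‖g x - g y‖ + ‖x - y‖ / 2 := by field_simp
    push_cast
    linarith
  have hle := hausdorffMeasure_image_le_of_dist_le (f := id) hd hdist
  rw [image_id, measure_mono_null (image_mono inter_subset_left) h0, mul_zero] at hle
  exact le_antisymm hle zero_le

end InjectiveDerivative

/-- The radial projection is differentiable away from its centre, and the kernel of its derivative
consists of radial vectors. -/
theorem exists_hasStrictFDerivAt_radialProj {n : ℕ} {x y : EuclideanSpace ℝ (Fin n)} (h : y ≠ x) :
    ∃ D : EuclideanSpace ℝ (Fin n) →L[ℝ] EuclideanSpace ℝ (Fin n),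
      HasStrictFDerivAt (radialProj x) D y ∧ ∀ v, D v = 0 → ∃ c : ℝ, v = c • (y - x) := by
  have hyx : y - x ≠ 0 := sub_ne_zero.2 h
  have hu : ContDiffAt ℝ 1 (fun z : EuclideanSpace ℝ (Fin n) => ‖z - x‖⁻¹) y :=
    ((contDiffAt_id.sub contDiffAt_const).norm ℝ hyx).inv (norm_ne_zero_iff.2 hyx)
  have hid : HasStrictFDerivAt (fun z : EuclideanSpace ℝ (Fin n) => z - x)
      (ContinuousLinearMap.id ℝ _) y := (hasStrictFDerivAt_id y).sub_const x
  refine ⟨_, (hu.hasStrictFDerivAt one_ne_zero).smul hid, fun v hv => ?_⟩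
  simp only [FunLike.coe_add, Pi.add_apply, FunLike.coe_smul, Pi.smul_apply,
    ContinuousLinearMap.id_apply, ContinuousLinearMap.smulRight_apply] at hv
  set b := fderiv ℝ (fun z : EuclideanSpace ℝ (Fin n) => ‖z - x‖⁻¹) y v
  refine ⟨-(‖y - x‖ * b), ?_⟩
  have := congrArg (fun w => ‖y - x‖ • w) hv
  simp only [smul_add, smul_zero, smul_smul, mul_inv_cancel₀ (norm_ne_zero_iff.2 hyx),
    one_smul] at this
  rw [neg_smul]
  exact eq_neg_of_add_eq_zero_left this

/-- If the image of a set `A` of regular points has null radial projection from `x`, then almost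
every tangent plane along `A` passes through `x`. -/
theorem hausdorffMeasure_sub_notMem_range_eq_zero {m n : ℕ}
    {f : EuclideanSpace ℝ (Fin m) → EuclideanSpace ℝ (Fin n)} (hf : ContDiff ℝ 1 f)
    {A : Set (EuclideanSpace ℝ (Fin m))} (hA : ∀ a ∈ A, Function.Injective (fderiv ℝ f a))
    {x : EuclideanSpace ℝ (Fin n)} {d : ℝ} (hd : 0 ≤ d)
    (h0 : μH[d] (radialProj x '' (f '' A \ {x})) = 0) :
    μH[d] {a ∈ A | x - f a ∉ range (fderiv ℝ f a)} = 0 := by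
  set B := {a ∈ A | x - f a ∉ range (fderiv ℝ f a)}
  have hne : ∀ a ∈ B, f a ≠ x := by
    rintro a ⟨-, ha⟩ rfl
    exact ha ⟨0, by simp⟩
  choose! D hD hker using fun a ha => exists_hasStrictFDerivAt_radialProj (hne a ha)
  refine hausdorffMeasure_eq_zero_of_image_of_hasStrictFDerivAt (g := radialProj x ∘ f)
    (g' := fun a => (D a).comp (fderiv ℝ f a)) hd
    (fun a ha => (hD a ha).comp a (hf.contDiffAt.hasStrictFDerivAt one_ne_zero)) ?_ ?_
  · intro a ha
    rw [injective_iff_map_eq_zero]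
    intro w hw
    obtain ⟨c, hc⟩ : ∃ c : ℝ, fderiv ℝ f a w = c • (f a - x) := hker a ha _ hw
    have hc0 : c = 0 := by
      by_contra hc0
      refine ha.2 ⟨-(c⁻¹ • w), ?_⟩
      rw [map_neg, map_smul, hc, smul_smul, inv_mul_cancel₀ hc0, one_smul, neg_sub]
    refine (injective_iff_map_eq_zero _).1 (hA a ha.1) w ?_
    rw [hc, hc0, zero_smul]
  · refine measure_mono_null ?_ h0
    rintro _ ⟨a, ha, rfl⟩
    exact ⟨f a, ⟨⟨a, ha.1, rfl⟩, hne a ha⟩, rfl⟩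

/-- A set of positive measure covered by countably many `C¹` images has a `C¹` parametrization
which hits it at a non-null set of regular points. -/
theorem IsRectifiableSet.exists_regular_ne_zero {m n : ℕ} {E : Set (EuclideanSpace ℝ (Fin n))}
    (hE : IsRectifiableSet m n E) :
    ∃ f : EuclideanSpace ℝ (Fin m) → EuclideanSpace ℝ (Fin n), ContDiff ℝ 1 f ∧
      μH[(m : ℝ)] {a | f a ∈ E ∧ Function.Injective (fderiv ℝ f a)} ≠ 0 := by
  obtain ⟨-, hpos, f, hf, hcov⟩ := hE
  by_contra! hnull
  refine hpos.ne' ?_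
  have hsub : E ⊆ (E \ ⋃ i, range (f i)) ∪
      ⋃ i, (f i '' {a | f i a ∈ E ∧ Function.Injective (fderiv ℝ (f i) a)} ∪
        f i '' {a | ¬ Function.Injective (fderiv ℝ (f i) a)}) := by
    intro y hy
    by_cases hyf : y ∈ ⋃ i, range (f i)
    · obtain ⟨i, a, rfl⟩ := mem_iUnion.1 hyf
      refine Or.inr (mem_iUnion.2 ⟨i, ?_⟩)
      by_cases ha : Function.Injective (fderiv ℝ (f i) a)
      · exact Or.inl ⟨a, ⟨hy, ha⟩, rfl⟩
      · exact Or.inr ⟨a, ha, rfl⟩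
    · exact Or.inl ⟨hy, hyf⟩
  refine measure_mono_null hsub (measure_union_null hcov
    (measure_iUnion_null fun i => measure_union_null ?_ ?_))
  · have h := hausdorffMeasure_image_eq_zero_of_hasFDerivAt (f' := fderiv ℝ (f i))
      (s := {a | f i a ∈ E ∧ Function.Injective (fderiv ℝ (f i) a)})
      (fun a _ => ((hf i).1.differentiable one_ne_zero a).hasFDerivAt)
    rw [finrank_euclideanSpace_fin] at h
    exact h (hnull (f i) (hf i).1)
  · have h := hausdorffMeasure_image_eq_zero_of_not_injective (f' := fderiv ℝ (f i))
      (s := {a | ¬ Function.Injective (fderiv ℝ (f i) a)})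
      (fun a _ => ((hf i).1.differentiable one_ne_zero a).hasFDerivAt) fun _ => id
    rwa [finrank_euclideanSpace_fin] at h

/-- If `E ⊆ ℝⁿ` is `m`-rectifiable and not contained in any affine `m`-plane, then there is a
point `x ∈ E` from which the radial projection `π_x(E \ {x})` has positive `ℋᵐ` measure. -/
theorem stmt7 {n m : ℕ} (hm : 0 < m) (hmn : m < n)
    (E : Set (EuclideanSpace ℝ (Fin n)))
    (hE : IsRectifiableSet m n E)
    (hflat : ¬ ∃ T : Set (EuclideanSpace ℝ (Fin n)), IsAffinePlane m T ∧ E ⊆ T) :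
    ∃ x ∈ E, 0 < μH[(m : ℝ)] (radialProj x '' (E \ {x})) := by
  by_contra! hnull
  obtain ⟨f, hf, hpos⟩ := hE.exists_regular_ne_zero
  set A := {a | f a ∈ E ∧ Function.Injective (fderiv ℝ f a)}
  obtain ⟨t, htE, htc, hEt⟩ :=
    (TopologicalSpace.IsSeparable.of_separableSpace E).exists_countable_dense_subset
  have hbad : μH[(m : ℝ)] (⋃ x ∈ t,
      {a ∈ A | x - f a ∉ range (fderiv ℝ f a)}) = 0 := by
    refine (measure_biUnion_null_iff htc).2 fun x hx =>
      hausdorffMeasure_sub_notMem_range_eq_zero hf (fun a ha => ha.2) (Nat.cast_nonneg m) ?_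
    refine measure_mono_null (image_mono (sdiff_subset_sdiff_left ?_))
      (nonpos_iff_eq_zero.1 (hnull x (htE hx)))
    rintro _ ⟨a, ha, rfl⟩
    exact ha.1
  obtain ⟨a, haA, ha⟩ : ∃ a ∈ A, a ∉ ⋃ x ∈ t,
      {a ∈ A | x - f a ∉ range (fderiv ℝ f a)} := by
    by_contra! h
    exact hpos (measure_mono_null h hbad)
  set W := LinearMap.range (fderiv ℝ f a : EuclideanSpace ℝ (Fin m) →ₗ[ℝ] EuclideanSpace ℝ (Fin n))
  refine hflat ⟨_, ⟨W, f a, ?_, rfl⟩, ?_⟩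
  · rw [LinearMap.finrank_range_of_inj haA.2, finrank_euclideanSpace_fin]
  · have hclosed : IsClosed {x | x - f a ∈ W} :=
      W.closed_of_finiteDimensional.preimage (continuous_id.sub continuous_const)
    have htW : t ⊆ {x | x - f a ∈ W} := by
      intro x hx
      by_contra hxW
      exact ha (mem_iUnion₂.2 ⟨x, hx, haA, hxW⟩)
    intro x hx
    exact ⟨x - f a, closure_minimal htW hclosed (hEt hx), add_sub_cancel _ _⟩
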